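/- Let P_{XY} ∈ 𝒜 = {P_{XY} : P_{X|Y}(x|y) > 0 for all (x,y)}. For any good sequence of (n,R_n) coordination codes for P_{Y|X}, it holds that lim_{n→∞} (1/n) E[ log ( ∏_{i=1}^n P_{X|Y}(X_i|Y_i) / ∏_{i=1}^n P_X(X_i) ) ] = I(X;Y), where the expectation is with respect to the code-induced joint distribution P_{X^nY^n} and I(X;Y) is the mutual information under P_{XY}. -/

import Mathlib

open scoped BigOperators ENNReal Classical
open Filter

section InformationDefs

variable {α X Y : Type*}

/-- A probability mass function on a finite alphabet. -/
def IsPMF [Fintype α] (P : α → ℝ) : Prop :=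
  (∀ a, 0 ≤ P a) ∧ ∑ a, P a = 1

/-- Variational distance `‖P − Q‖ = sup_A |P(A) − Q(A)|` on a finite alphabet. -/
noncomputable def tvDist [Fintype α] (P Q : α → ℝ) : ℝ :=
  Finset.univ.powerset.sup' ⟨∅, Finset.empty_mem_powerset _⟩
    fun A => |∑ a ∈ A, P a - ∑ a ∈ A, Q a|

/-- Relative entropy `D(P‖Q) = ∑ P log(P/Q)` on a finite alphabet, infinite when
`P` is not absolutely continuous with respect to `Q`. -/
noncomputable def relEnt [Fintype α] (P Q : α → ℝ) : ℝ≥0∞ :=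
  if ∀ a, Q a = 0 → P a = 0 then
    ENNReal.ofReal (∑ a, P a * Real.log (P a / Q a))
  else ⊤

/-- Shannon entropy on a finite alphabet. -/
noncomputable def entropy [Fintype α] (P : α → ℝ) : ℝ :=
  -∑ a, P a * Real.log (P a)

/-- First (X-) marginal of a joint distribution. -/
noncomputable def margX [Fintype Y] (P : X × Y → ℝ) : X → ℝ :=
  fun x => ∑ y, P (x, y)

/-- Second (Y-) marginal of a joint distribution. -/
noncomputable def margY [Fintype X] (P : X × Y → ℝ) : Y → ℝ :=
  fun y => ∑ x, P (x, y)

/-- Backward conditional distribution `P_{X|Y}(x|y) = P(x,y)/P_Y(y)`. -/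
noncomputable def condXY [Fintype X] (P : X × Y → ℝ) : X → Y → ℝ :=
  fun x y => P (x, y) / margY P y

/-- Forward conditional distribution `P_{Y|X}(y|x) = P(x,y)/P_X(x)`. -/
noncomputable def condYX [Fintype Y] (P : X × Y → ℝ) : Y → X → ℝ :=
  fun y x => P (x, y) / margX P x

/-- Mutual information `I(X;Y)` of a joint distribution on a finite product alphabet. -/
noncomputable def mutualInfo [Fintype X] [Fintype Y] (P : X × Y → ℝ) : ℝ :=
  ∑ x, ∑ y, P (x, y) * Real.log (P (x, y) / (margX P x * margY P y))

/-- A block code of length `n`: an encoder into `{1,…,M}` and a decoder. -/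
structure Code (X Y : Type*) (n : ℕ) where
  M : ℕ
  hM : 0 < M
  enc : (Fin n → X) → Fin M
  dec : Fin M → Fin n → Y

/-- Rate `R_n = (1/n) log M` of a code. -/
noncomputable def Code.rate {X Y : Type*} {n : ℕ} (c : Code X Y n) : ℝ :=
  Real.log c.M / n

/-- The reconstruction sequence `Yⁿ = g_n(f_n(xⁿ))` produced by a code. -/
def Code.out {X Y : Type*} {n : ℕ} (c : Code X Y n) (xs : Fin n → X) : Fin n → Y :=
  c.dec (c.enc xs)

/-- The i.i.d. (memoryless) source distribution on `n`-blocks. -/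
noncomputable def iid (PX : X → ℝ) (n : ℕ) : (Fin n → X) → ℝ :=
  fun xs => ∏ i, PX (xs i)

/-- The code-induced joint distribution
`P_{XⁿYⁿ}(xⁿ,yⁿ) = ∏ P_X(x_i) · 1{yⁿ = g_n(f_n(xⁿ))}`. -/
noncomputable def inducedJoint [DecidableEq Y] (PX : X → ℝ) {n : ℕ} (c : Code X Y n) :
    (Fin n → X) × (Fin n → Y) → ℝ :=
  fun p => (∏ i, PX (p.1 i)) * (if p.2 = c.out p.1 then 1 else 0)

/-- The approximating joint distribution
`Q_{XⁿYⁿ}(xⁿ,yⁿ) = (|g_n⁻¹(yⁿ)|/M) · ∏ P_{X|Y}(x_i|y_i)`: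
a uniformly chosen codeword passed through the backward memoryless channel. -/
noncomputable def approxJoint [Fintype X] [DecidableEq Y] (PXY : X × Y → ℝ) {n : ℕ}
    (c : Code X Y n) : (Fin n → X) × (Fin n → Y) → ℝ :=
  fun p => (((Finset.univ.filter fun m => c.dec m = p.2).card : ℝ) / c.M) *
    ∏ i, condXY PXY (p.1 i) (p.2 i)

/-- The uniform distribution over the codebook, `Q_{Yⁿ}(yⁿ) = |g_n⁻¹(yⁿ)|/M`. -/
noncomputable def codebookUniform [DecidableEq Y] {n : ℕ} (c : Code X Y n) :
    (Fin n → Y) → ℝ :=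
  fun ys => ((Finset.univ.filter fun m => c.dec m = ys).card : ℝ) / c.M

/-- The empirical (joint type) distribution of a pair of sequences. -/
noncomputable def empDist [DecidableEq X] [DecidableEq Y] {n : ℕ}
    (xs : Fin n → X) (ys : Fin n → Y) : X × Y → ℝ :=
  fun p => ((Finset.univ.filter fun i => xs i = p.1 ∧ ys i = p.2).card : ℝ) / n

/-- `‖T_{XⁿYⁿ} − P_{XY}‖ → 0` in probability under the i.i.d. source. -/
def TVInProb [Fintype X] [Fintype Y] [DecidableEq X] [DecidableEq Y]
    (PX : X → ℝ) (PXY : X × Y → ℝ) (c : ∀ n, Code X Y n) : Prop :=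
  ∀ ε : ℝ, 0 < ε →
    Tendsto (fun n => ∑ xs : Fin n → X,
        if ε < tvDist (empDist xs ((c n).out xs)) PXY then iid PX n xs else 0)
      atTop (nhds 0)

/-- A good sequence of coordination codes for `P_{Y|X}` (specified via the joint `PXY`):
the rates converge to `I(X;Y)` and the empirical distribution converges to `PXY`
in variational distance, in probability. -/
def GoodCoord [Fintype X] [Fintype Y] [DecidableEq X] [DecidableEq Y]
    (PX : X → ℝ) (PXY : X × Y → ℝ) (c : ∀ n, Code X Y n) : Prop :=
  Tendsto (fun n => (c n).rate) atTop (nhds (mutualInfo PXY)) ∧ TVInProb PX PXY c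

end InformationDefs

lemma abs_sub_le_tvDist {α : Type*} [Fintype α] (P Q : α → ℝ) (a : α) :
    |P a - Q a| ≤ tvDist P Q := by
  have h := Finset.le_sup' (s := (Finset.univ : Finset α).powerset)
    (fun A => |∑ a ∈ A, P a - ∑ a ∈ A, Q a|) (b := {a}) (by simp)
  simpa [tvDist] using h

lemma empDist_nonneg {X Y : Type*} [DecidableEq X] [DecidableEq Y] {n : ℕ}
    (xs : Fin n → X) (ys : Fin n → Y) (p : X × Y) : 0 ≤ empDist xs ys p := by
  unfold empDist
  positivity

lemma empDist_le_one {X Y : Type*} [DecidableEq X] [DecidableEq Y] {n : ℕ}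
    (xs : Fin n → X) (ys : Fin n → Y) (p : X × Y) : empDist xs ys p ≤ 1 := by
  unfold empDist
  refine div_le_one_of_le₀ ?_ (Nat.cast_nonneg n)
  exact_mod_cast (Finset.card_le_univ _).trans_eq (Fintype.card_fin n)

/-- Averages along a pair of sequences are expectations under the empirical distribution. -/
lemma average_eq_sum_empDist {X Y : Type*} [Fintype X] [Fintype Y]
    [DecidableEq X] [DecidableEq Y] {n : ℕ}
    (xs : Fin n → X) (ys : Fin n → Y) (L : X × Y → ℝ) :
    (1 / (n : ℝ)) * ∑ i, L (xs i, ys i) = ∑ p, empDist xs ys p * L p := by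
  have key : ∀ p, empDist xs ys p * L p
      = (1 / (n : ℝ)) * ∑ i, if (xs i, ys i) = p then L p else 0 := by
    intro p
    rw [← Finset.sum_filter, Finset.sum_const, nsmul_eq_mul]
    simp only [empDist, Prod.ext_iff]
    ring
  simp_rw [key, ← Finset.mul_sum]
  rw [Finset.sum_comm]
  simp

lemma iid_nonneg {X : Type*} {PX : X → ℝ} (h : ∀ x, 0 ≤ PX x) (n : ℕ) (xs : Fin n → X) :
    0 ≤ iid PX n xs :=
  Finset.prod_nonneg fun _ _ => h _

lemma sum_iid {X : Type*} [Fintype X] {PX : X → ℝ} (h : ∑ x, PX x = 1) (n : ℕ) :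
    ∑ xs : Fin n → X, iid PX n xs = 1 := by
  simp only [iid]
  rw [← Fintype.sum_pow, h, one_pow]

/-- Under convergence of the empirical distribution in probability, expected averages of a
function on the alphabet converge to its expectation under the limiting distribution. -/
lemma TVInProb.tendsto_expectation_average {X Y : Type*} [Fintype X] [Fintype Y]
    [DecidableEq X] [DecidableEq Y] {PX : X → ℝ} (hPX : IsPMF PX) {PXY : X × Y → ℝ}
    (hnonneg : ∀ p, 0 ≤ PXY p) (hle : ∀ p, PXY p ≤ 1) {c : ∀ n, Code X Y n}
    (hc : TVInProb PX PXY c) (L : X × Y → ℝ) :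
    Tendsto (fun n : ℕ => ∑ xs : Fin n → X,
      iid PX n xs * ((1 / (n : ℝ)) * ∑ i, L (xs i, (c n).out xs i)))
      atTop (nhds (∑ p, PXY p * L p)) := by
  set C := ∑ p, |L p|
  have hC : 0 ≤ C := Finset.sum_nonneg fun _ _ => abs_nonneg _
  have pointwise : ∀ ε > 0, ∀ n : ℕ, ∀ xs : Fin n → X,
      |(1 / (n : ℝ)) * ∑ i, L (xs i, (c n).out xs i) - ∑ p, PXY p * L p|
        ≤ (ε + if ε < tvDist (empDist xs ((c n).out xs)) PXY then 1 else 0) * C := by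
    intro ε hε n xs
    rw [average_eq_sum_empDist, ← Finset.sum_sub_distrib, Finset.mul_sum]
    refine (Finset.abs_sum_le_sum_abs _ _).trans (Finset.sum_le_sum fun p _ => ?_)
    rw [← sub_mul, abs_mul]
    refine mul_le_mul_of_nonneg_right ?_ (abs_nonneg _)
    split_ifs with h
    · rw [abs_le]
      have := empDist_nonneg xs ((c n).out xs) p
      have := empDist_le_one xs ((c n).out xs) p
      have := hnonneg p
      have := hle p
      constructor <;> linarith
    · exact (abs_sub_le_tvDist _ _ p).trans (by linarith)
  rw [Metric.tendsto_atTop]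
  intro δ hδ
  set ε := δ / (2 * (C + 1))
  have hε : 0 < ε := by positivity
  obtain ⟨N, hN⟩ := Metric.tendsto_atTop.1 (hc ε hε) ε hε
  refine ⟨N, fun n hn => ?_⟩
  have hprob := (abs_lt.1 (by simpa [Real.dist_eq] using hN n hn)).2
  calc dist _ _
      = |∑ xs : Fin n → X, iid PX n xs *
          ((1 / (n : ℝ)) * ∑ i, L (xs i, (c n).out xs i) - ∑ p, PXY p * L p)| := by
        simp_rw [Real.dist_eq, mul_sub, Finset.sum_sub_distrib]
        rw [← Finset.sum_mul, sum_iid hPX.2, one_mul]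
    _ ≤ ∑ xs : Fin n → X, iid PX n xs *
          ((ε + if ε < tvDist (empDist xs ((c n).out xs)) PXY then 1 else 0) * C) := by
        refine (Finset.abs_sum_le_sum_abs _ _).trans (Finset.sum_le_sum fun xs _ => ?_)
        rw [abs_mul, abs_of_nonneg (iid_nonneg hPX.1 n xs)]
        exact mul_le_mul_of_nonneg_left (pointwise ε hε n xs) (iid_nonneg hPX.1 n xs)
    _ = (ε + ∑ xs : Fin n → X,
          if ε < tvDist (empDist xs ((c n).out xs)) PXY then iid PX n xs else 0) * C := by
        simp_rw [← mul_assoc, ← Finset.sum_mul, mul_add, Finset.sum_add_distrib,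
          ← Finset.sum_mul, sum_iid hPX.2, mul_ite, mul_one, mul_zero, one_mul]
    _ ≤ (ε + ε) * C := by gcongr
    _ < (ε + ε) * (C + 1) := by gcongr; linarith
    _ = δ := by simp only [ε]; field_simp; ring

/-- For `P_{XY} ∈ 𝒜` and any good sequence of coordination codes for `P_{Y|X}`,
`(1/n) E[ log ( ∏ᵢ P_{X|Y}(Xᵢ|Yᵢ) / ∏ᵢ P_X(Xᵢ) ) ] → I(X;Y)`, the expectation being
taken under the code-induced joint distribution. -/
theorem good_coordination_codes_log_ratio_limit
    {X Y : Type*} [Fintype X] [Fintype Y] [DecidableEq X] [DecidableEq Y]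
    (PX : X → ℝ) (hPX : IsPMF PX) (hPXfull : ∀ x, 0 < PX x)
    (W : X → Y → ℝ) (hW : ∀ x, IsPMF (W x))
    (PXY : X × Y → ℝ) (hPXY : ∀ x y, PXY (x, y) = PX x * W x y)
    (hA : ∀ x y, 0 < condXY PXY x y)
    (c : ∀ n, Code X Y n) (hgood : GoodCoord PX PXY c) :
    Tendsto
      (fun n : ℕ => (1 / (n : ℝ)) * ∑ xs : Fin n → X,
        iid PX n xs *
          Real.log ((∏ i, condXY PXY (xs i) ((c n).out xs i)) / ∏ i, PX (xs i)))
      atTop (nhds (mutualInfo PXY)) := by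
  have hmargX : ∀ x, margX PXY x = PX x := fun x => by
    simp only [margX, hPXY, ← Finset.mul_sum, (hW x).2, mul_one]
  have hnonneg : ∀ p, 0 ≤ PXY p := fun p => by
    rw [← Prod.mk.eta (p := p), hPXY]
    exact mul_nonneg (hPX.1 _) ((hW _).1 _)
  have hsum : ∑ p, PXY p = 1 := by
    rw [Fintype.sum_prod_type, ← hPX.2]
    exact Finset.sum_congr rfl fun x _ => hmargX x
  have hle : ∀ p, PXY p ≤ 1 := fun p =>
    hsum ▸ Finset.single_le_sum (fun q _ => hnonneg q) (Finset.mem_univ p)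
  have hlim := TVInProb.tendsto_expectation_average hPX hnonneg hle hgood.2
    fun p => Real.log (condXY PXY p.1 p.2 / PX p.1)
  convert hlim using 1
  · funext n
    rw [Finset.mul_sum]
    refine Finset.sum_congr rfl fun xs _ => ?_
    rw [← Finset.prod_div_distrib,
      Real.log_prod fun i _ => (div_pos (hA _ _) (hPXfull _)).ne']
    ring
  · rw [Fintype.sum_prod_type]
    simp only [mutualInfo, hmargX, condXY, div_div, mul_comm (PX _)]
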